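/- arXiv:1509.01371 — 2 statements merged into one kernel-verified Lean document; each statement's English description precedes it below -/
import Mathlib

section
/- Let m be odd. Then #{a ∈ F_r^* : η(a)·η̄(Tr(a^{-1})) = 1} = (p−1)·(p^{m-1} + (-1)^{((p-1)/2)·((m-1)/2)} p^{(m-1)/2})/2 and #{a ∈ F_r^* : η(a)·η̄(Tr(a^{-1})) = -1} = (p−1)·(p^{m-1} − (-1)^{((p-1)/2)·((m-1)/2)} p^{(m-1)/2})/2. -/
theorem quadraticChar_sum_addChar_mul {K R : Type*} [Field K] [Fintype K] [DecidableEq K]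
    [CommRing R] (hK : ringChar K ≠ 2) (ψ : AddChar K R) (t : K) :
    ∑ c, (quadraticChar K c : R) * ψ (t * c) =
      quadraticChar K t * gaussSum ((quadraticChar K).ringHomComp (Int.castRingHom R)) ψ := by
  rcases eq_or_ne t 0 with rfl | ht
  · simp only [zero_mul, AddChar.map_zero_eq_one, mul_one, quadraticChar_zero, Int.cast_zero]
    exact_mod_cast congrArg (Int.cast (R := R)) (quadraticChar_sum_zero hK)
  · have hsq : ((quadraticChar K t : R)) * quadraticChar K t = 1 := by
      rw [← sq]
      exact_mod_cast congrArg (Int.cast (R := R)) (quadraticChar_sq_one ht)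
    have h := gaussSum_mulShift ((quadraticChar K).ringHomComp (Int.castRingHom R)) ψ
      (Units.mk0 t ht)
    rw [← h, ← mul_assoc]
    simp only [gaussSum, AddChar.mulShift_apply, MulChar.ringHomComp_apply, Units.val_mk0,
      eq_intCast, hsq, one_mul]

theorem sum_addChar_mul_sq {K R : Type*} [Field K] [Fintype K] [DecidableEq K]
    [CommRing R] [IsDomain R] (hK : ringChar K ≠ 2) {ψ : AddChar K R} (hψ : ψ.IsPrimitive)
    {t : K} (ht : t ≠ 0) :
    ∑ x, ψ (t * x ^ 2) =
      quadraticChar K t * gaussSum ((quadraticChar K).ringHomComp (Int.castRingHom R)) ψ := by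
  have hsum : ∑ a, ψ (t * a) = 0 := by
    have := AddChar.sum_eq_zero_of_ne_one (hψ ht)
    simpa [AddChar.mulShift_apply] using this
  rw [← quadraticChar_sum_addChar_mul hK,
    ← Finset.sum_fiberwise_of_maps_to (s := Finset.univ) (t := Finset.univ)
      (g := fun x : K => x ^ 2) (fun _ _ => Finset.mem_univ _)]
  have key (a : K) : ∑ x with x ^ 2 = a, ψ (t * x ^ 2) =
      (quadraticChar K a : R) * ψ (t * a) + ψ (t * a) := by
    have hcard := congrArg (Int.cast (R := R)) (quadraticChar_card_sqrts hK a)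
    rw [Set.toFinset_ofPred] at hcard
    push_cast at hcard
    rw [Finset.sum_congr rfl (g := fun _ => ψ (t * a)) (by simp +contextual), Finset.sum_const,
      nsmul_eq_mul, hcard]
    ring
  rw [Finset.sum_congr rfl fun a _ => key a, Finset.sum_add_distrib, hsum, add_zero]

theorem isSquare_of_isSquare_algebraMap {K L : Type*} [Field K] [Field L] [Algebra K L]
    [FiniteDimensional K L] (h : Odd (Module.finrank K L)) {c : K}
    (hc : IsSquare (algebraMap K L c)) : IsSquare c := by
  obtain ⟨k, hk⟩ := h
  obtain ⟨y, hy⟩ := hc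
  rcases eq_or_ne c 0 with rfl | h0
  · exact IsSquare.zero
  have hN := congrArg (Algebra.norm K) hy
  rw [Algebra.norm_algebraMap, map_mul, hk] at hN
  refine ⟨Algebra.norm K y / c ^ k, ?_⟩
  field_simp
  rw [sq (Algebra.norm K y), ← hN]
  ring

theorem quadraticChar_algebraMap {K L : Type*} [Field K] [Fintype K] [DecidableEq K]
    [Field L] [Fintype L] [DecidableEq L] [Algebra K L] (h : Odd (Module.finrank K L)) (c : K) :
    quadraticChar L (algebraMap K L c) = quadraticChar K c := by
  rcases eq_or_ne c 0 with rfl | h0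
  · simp
  have h0' : algebraMap K L c ≠ 0 := by simpa
  by_cases hc : IsSquare c
  · rw [(quadraticChar_one_iff_isSquare h0).2 hc,
      (quadraticChar_one_iff_isSquare h0').2 (hc.map _)]
  · rw [quadraticChar_neg_one_iff_not_isSquare.2 hc, quadraticChar_neg_one_iff_not_isSquare.2
      (mt (isSquare_of_isSquare_algebraMap h) hc)]

open Matrix in
theorem isSquare_algebraMap_discr {K L ι : Type*} [Field K] [Field L] [Algebra K L]
    [FiniteDimensional K L] [IsGalois K L] [Fintype ι] [DecidableEq ι] (b : Module.Basis ι K L) :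
    IsSquare (algebraMap K L (Algebra.discr K b)) := by
  have hcard : Fintype.card ι = Fintype.card Gal(L/K) := by
    rw [← Nat.card_eq_fintype_card (α := Gal(L/K)), IsGalois.card_aut_eq_finrank,
      Module.finrank_eq_card_basis b]
  let e := Fintype.equivOfCardEq hcard
  let M : Matrix ι ι L := Matrix.of fun i j => e j (b i)
  refine ⟨M.det, ?_⟩
  have hM : (Algebra.traceMatrix K b).map (algebraMap K L) = M * Mᵀ := by
    ext i j
    simp only [Matrix.map_apply, Algebra.traceMatrix_apply, Algebra.traceForm_apply,
      trace_eq_sum_automorphisms, Matrix.mul_apply, Matrix.transpose_apply, M, Matrix.of_apply,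
      map_mul]
    exact (e.sum_comp fun σ => σ (b i) * σ (b j)).symm
  rw [Algebra.discr_def, RingHom.map_det, RingHom.mapMatrix_apply, hM, Matrix.det_mul,
    Matrix.det_transpose]

theorem AddChar.map_finset_sum {A M ι : Type*} [AddCommMonoid A] [CommMonoid M]
    (ψ : AddChar A M) (s : Finset ι) (f : ι → A) : ψ (∑ i ∈ s, f i) = ∏ i ∈ s, ψ (f i) := by
  classical
  induction s using Finset.induction_on with
  | empty => simp
  | insert i s hi ih => rw [Finset.sum_insert hi, Finset.prod_insert hi, map_add_eq_mul, ih]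

theorem gaussSum_quadraticChar_trace {K L R : Type*} [Field K] [Fintype K] [DecidableEq K]
    [Field L] [Fintype L] [DecidableEq L] [Algebra K L] [CommRing R] [IsDomain R]
    (hK : ringChar K ≠ 2) (h : Odd (Module.finrank K L))
    {ψ : AddChar K R} (hψ : ψ.IsPrimitive) :
    gaussSum ((quadraticChar L).ringHomComp (Int.castRingHom R))
        (ψ.compAddMonoidHom (Algebra.trace K L).toAddMonoidHom) =
      gaussSum ((quadraticChar K).ringHomComp (Int.castRingHom R)) ψ ^ Module.finrank K L := by
  have hL : ringChar L ≠ 2 := by rwa [← Algebra.ringChar_eq K L]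
  set ψ' := ψ.compAddMonoidHom (Algebra.trace K L).toAddMonoidHom
  have hψ'_apply (x : L) : ψ' x = ψ (Algebra.trace K L x) := rfl
  have hψ' : ψ'.IsPrimitive := by
    apply AddChar.IsPrimitive.of_ne_one
    obtain ⟨a, ha⟩ := AddChar.ne_one_iff.1 (by simpa using hψ one_ne_zero)
    obtain ⟨x, rfl⟩ := Algebra.trace_surjective K L a
    exact AddChar.ne_one_iff.2 ⟨x, ha⟩
  have h2 : (2 : K) ≠ 0 := Ring.two_ne_zero hK
  let : Invertible (2 : K) := invertibleOfNonzero h2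
  obtain ⟨v, hv⟩ := LinearMap.BilinForm.exists_orthogonal_basis
    (LinearMap.BilinForm.isSymm_iff.1 (Algebra.traceForm_isSymm K (S := L)))
  let w i := Algebra.trace K L (v i * v i)
  have hdiag : Algebra.traceMatrix K v = Matrix.diagonal w := by
    ext i j
    rcases eq_or_ne i j with rfl | hij
    · simp [w, Algebra.traceMatrix_apply]
    · rw [Matrix.diagonal_apply_ne _ hij]
      exact hv hij
  have hdiscr : Algebra.discr K v = ∏ i, w i := by
    rw [Algebra.discr_def, hdiag, Matrix.det_diagonal]
  have hne : ∏ i, w i ≠ 0 := hdiscr ▸ Algebra.discr_not_zero_of_basis K v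
  have hw i : w i ≠ 0 := Finset.prod_ne_zero_iff.1 hne i (Finset.mem_univ i)
  have hsq : quadraticChar K (∏ i, w i) = 1 := by
    rw [quadraticChar_one_iff_isSquare hne, ← hdiscr]
    exact isSquare_of_isSquare_algebraMap h (isSquare_algebraMap_discr v)
  have htr (x : Fin (Module.finrank K L) → K) :
      Algebra.trace K L (v.equivFun.symm x ^ 2) = ∑ i, w i * x i ^ 2 := by
    rw [v.equivFun_symm_apply, sq, Finset.sum_mul_sum, map_sum]
    refine Finset.sum_congr rfl fun i _ => ?_
    rw [map_sum, Finset.sum_eq_single i]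
    · simp [w]; ring
    · intro j _ hj
      have : Algebra.trace K L (v i * v j) = 0 := hv hj.symm
      simp [this]
    · simp
  have hG : gaussSum ((quadraticChar L).ringHomComp (Int.castRingHom R)) ψ' =
      ∑ x, ψ' (x ^ 2) := by
    simpa using (sum_addChar_mul_sq hL hψ' one_ne_zero).symm
  rw [hG, ← v.equivFun.symm.toEquiv.sum_comp]
  simp only [LinearEquiv.coe_toEquiv, hψ'_apply, htr, AddChar.map_finset_sum]
  rw [← Fintype.piFinset_univ, ← Finset.prod_univ_sum (fun _ => Finset.univ)
    (fun i (x : K) => ψ (w i * x ^ 2))]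
  simp only [sum_addChar_mul_sq hK hψ (hw _)]
  rw [Finset.prod_mul_distrib, Finset.prod_const, Finset.card_univ, Fintype.card_fin,
    ← Int.cast_prod, ← map_prod, hsq, Int.cast_one, one_mul]

theorem sum_quadraticChar_mul_quadraticChar_trace_of_isPrimitive {K L R : Type*} [Field K]
    [Fintype K] [DecidableEq K] [Field L] [Fintype L] [DecidableEq L] [Algebra K L]
    [CommRing R] [IsDomain R] [CharZero R] (hK : ringChar K ≠ 2)
    (h : Odd (Module.finrank K L)) {ψ : AddChar K R} (hψ : ψ.IsPrimitive) :
    ∑ b : L, quadraticChar L b * quadraticChar K (Algebra.trace K L b) =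
      (Fintype.card K - 1) *
        (quadraticChar K (-1) * Fintype.card K) ^ ((Module.finrank K L - 1) / 2) := by
  have hL : ringChar L ≠ 2 := by rwa [← Algebra.ringChar_eq K L]
  let ψ' := ψ.compAddMonoidHom (Algebra.trace K L).toAddMonoidHom
  let χ := (quadraticChar K).ringHomComp (Int.castRingHom R)
  let χ' := (quadraticChar L).ringHomComp (Int.castRingHom R)
  have hχ : χ ≠ 1 := by
    obtain ⟨a, ha⟩ := quadraticChar_exists_neg_one' hK
    intro h1
    have h2 := DFunLike.congr_fun h1 (a : K)
    rw [MulChar.one_apply a.isUnit, MulChar.ringHomComp_apply, ha] at h2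
    norm_num at h2
  have hχ_quad : χ.IsQuadratic := (quadraticChar_isQuadratic K).comp _
  have hG2 : gaussSum χ ψ ^ 2 = χ (-1) * Fintype.card K := gaussSum_sq hχ hχ_quad hψ
  have hG0 : gaussSum χ ψ ≠ 0 :=
    gaussSum_ne_zero_of_nontrivial (by simp) hχ hψ
  have hcount : ∑ c : K, (quadraticChar K c : R) * quadraticChar K c = Fintype.card K - 1 := by
    have hc (c : K) : (quadraticChar K c : R) * quadraticChar K c = 1 - if c = 0 then 1 else 0 := by
      split_ifs with h0
      · simp [h0]
      · rw [sub_zero, ← sq]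
        exact_mod_cast congrArg (Int.cast (R := R)) (quadraticChar_sq_one h0)
    simp only [hc, Finset.sum_sub_distrib]
    simp
  have hmain : (∑ b : L, (quadraticChar L b : R) * quadraticChar K (Algebra.trace K L b)) *
      gaussSum χ ψ = (Fintype.card K - 1) * gaussSum χ' ψ' := by
    rw [← hcount, Finset.sum_mul, Finset.sum_mul]
    have h1 (b : L) : (quadraticChar L b : R) * quadraticChar K (Algebra.trace K L b) *
        gaussSum χ ψ =
        ∑ c : K, quadraticChar L b * (quadraticChar K c * ψ (Algebra.trace K L b * c)) := by
      rw [mul_assoc, ← quadraticChar_sum_addChar_mul hK, Finset.mul_sum]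
    have h2 (c : K) : (quadraticChar K c : R) * quadraticChar K c * gaussSum χ' ψ' =
        ∑ b : L, quadraticChar L b * (quadraticChar K c * ψ (Algebra.trace K L b * c)) := by
      have h3 := quadraticChar_sum_addChar_mul hL ψ' (algebraMap K L c)
      rw [quadraticChar_algebraMap h] at h3
      rw [mul_assoc, ← h3, Finset.mul_sum]
      refine Finset.sum_congr rfl fun b _ => ?_
      have h4 : ψ' (algebraMap K L c * b) = ψ (Algebra.trace K L b * c) := by
        change ψ (Algebra.trace K L (algebraMap K L c * b)) = _
        rw [← Algebra.smul_def, map_smul, smul_eq_mul, mul_comm]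
      rw [h4]
      ring
    simp only [h1, h2]
    exact Finset.sum_comm
  rw [gaussSum_quadraticChar_trace hK h hψ] at hmain
  obtain ⟨k, hk⟩ := h
  have hfin : (∑ b : L, (quadraticChar L b : R) * quadraticChar K (Algebra.trace K L b)) =
      (Fintype.card K - 1) * (quadraticChar K (-1) * Fintype.card K) ^ k := by
    apply mul_right_cancel₀ hG0
    rw [hmain, hk, pow_succ, pow_mul, hG2, mul_assoc]
    rfl
  have hk' : (Module.finrank K L - 1) / 2 = k := by omega
  rw [hk']
  apply Int.cast_injective (α := R)
  push_cast
  exact hfin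

theorem sum_quadraticChar_mul_quadraticChar_trace {K L : Type*} [Field K] [Fintype K]
    [DecidableEq K] [Field L] [Fintype L] [DecidableEq L] [Algebra K L]
    (hK : ringChar K ≠ 2) (h : Odd (Module.finrank K L)) :
    ∑ b : L, quadraticChar L b * quadraticChar K (Algebra.trace K L b) =
      (Fintype.card K - 1) *
        (quadraticChar K (-1) * Fintype.card K) ^ ((Module.finrank K L - 1) / 2) :=
  sum_quadraticChar_mul_quadraticChar_trace_of_isPrimitive hK h
    (AddChar.FiniteField.primitiveChar K ℚ
      (by rw [ringChar.eq_zero]; exact (CharP.ringChar_ne_zero_of_finite K).symm)).prim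

theorem card_trace_ne_zero {K L : Type*} [Field K] [Fintype K] [DecidableEq K]
    [Field L] [Fintype L] [Algebra K L] :
    ((Finset.univ.filter fun b : L => Algebra.trace K L b ≠ 0).card : ℤ) =
      (Fintype.card K - 1) * (Fintype.card K : ℤ) ^ (Module.finrank K L - 1) := by
  have hrank := (Algebra.trace K L).finrank_range_add_finrank_ker
  rw [LinearMap.range_eq_top.2 (Algebra.trace_surjective K L), finrank_top,
    Module.finrank_self] at hrank
  have hker : (Finset.univ.filter fun b : L => Algebra.trace K L b = 0).card =
      Fintype.card K ^ (Module.finrank K L - 1) := by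
    have := Fintype.ofFinite (LinearMap.ker (Algebra.trace K L))
    rw [← hrank, Nat.add_sub_cancel_left, ← Module.card_eq_pow_finrank (K := K)
      (V := LinearMap.ker (Algebra.trace K L)), ← Fintype.card_subtype]
    exact Fintype.card_congr (Equiv.refl _)
  have htot := Finset.card_filter_add_card_filter_not (s := (Finset.univ : Finset L))
    (fun b => Algebra.trace K L b = 0)
  rw [hker, Finset.card_univ, Module.card_eq_pow_finrank (K := K) (V := L)] at htot
  have hpow : Fintype.card K ^ Module.finrank K L =
      Fintype.card K * Fintype.card K ^ (Module.finrank K L - 1) := by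
    rw [← pow_succ', ← hrank, Nat.add_sub_cancel_left, add_comm]
  rw [hpow] at htot
  zify at htot
  linarith

theorem two_mul_card_filter_eq {α : Type*} [Fintype α] (g : α → ℤ)
    (hg : ∀ a, g a = 0 ∨ g a = 1 ∨ g a = -1) {e : ℤ} (he : e = 1 ∨ e = -1) :
    2 * ((Finset.univ.filter fun a => g a = e).card : ℤ) = ∑ a, g a ^ 2 + e * ∑ a, g a := by
  rw [Finset.card_filter, Nat.cast_sum, Finset.mul_sum, Finset.mul_sum, ← Finset.sum_add_distrib]
  refine Finset.sum_congr rfl fun a _ => ?_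
  rcases he with rfl | rfl <;> rcases hg a with h | h | h <;> simp [h]

theorem two_mul_ncard_quadraticChar_mul_quadraticChar_trace_inv {K L : Type*} [Field K] [Fintype K]
    [DecidableEq K] [Field L] [Fintype L] [DecidableEq L] [Algebra K L]
    (hK : ringChar K ≠ 2) (h : Odd (Module.finrank K L)) {e : ℤ} (he : e = 1 ∨ e = -1) :
    2 * ({a : L | a ≠ 0 ∧
        quadraticChar L a * quadraticChar K (Algebra.trace K L a⁻¹) = e}.ncard : ℤ) =
      (Fintype.card K - 1) * ((Fintype.card K : ℤ) ^ (Module.finrank K L - 1) +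
        e * (quadraticChar K (-1) * Fintype.card K) ^ ((Module.finrank K L - 1) / 2)) := by
  let g (b : L) : ℤ := quadraticChar L b * quadraticChar K (Algebra.trace K L b)
  have hinv (a : L) : quadraticChar L a * quadraticChar K (Algebra.trace K L a⁻¹) = g a⁻¹ := by
    rcases eq_or_ne a 0 with rfl | ha
    · simp [g]
    · have : quadraticChar L a⁻¹ = quadraticChar L a := by
        rw [← mul_one (quadraticChar L a⁻¹), ← quadraticChar_sq_one ha, sq, ← mul_assoc, ← map_mul,
          inv_mul_cancel₀ ha, map_one, one_mul]
      rw [← this]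
  have hg (a : L) : g a = 0 ∨ g a = 1 ∨ g a = -1 := by
    rcases quadraticChar_isQuadratic L a with h1 | h1 | h1 <;>
      rcases quadraticChar_isQuadratic K (Algebra.trace K L a) with h2 | h2 | h2 <;>
        simp only [g, h1, h2] <;> norm_num
  have hset : {a : L | a ≠ 0 ∧ quadraticChar L a * quadraticChar K (Algebra.trace K L a⁻¹) = e} =
      (Finset.univ.filter fun a : L => g a⁻¹ = e : Finset L) := by
    ext a
    simp only [hinv, Set.mem_ofPred_eq, Finset.coe_filter, Finset.mem_univ, true_and,
      and_iff_right_iff_imp]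
    rintro ha rfl
    rcases he with rfl | rfl <;> simp [g] at ha
  have hsq (b : L) : g b ^ 2 = if Algebra.trace K L b ≠ 0 then 1 else 0 := by
    split_ifs with hb
    · have hb0 : b ≠ 0 := by
        rintro rfl
        simp at hb
      rw [mul_pow, quadraticChar_sq_one hb, quadraticChar_sq_one hb0, one_mul]
    · simp [g, not_not.1 hb]
  rw [hset, Set.ncard_coe_finset, two_mul_card_filter_eq _ (fun a => hg a⁻¹) he,
    Fintype.sum_equiv (Equiv.inv L) (fun a => g a⁻¹) g fun _ => rfl,
    Fintype.sum_equiv (Equiv.inv L) (fun a => g a⁻¹ ^ 2) (fun b => g b ^ 2) fun _ => rfl,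
    sum_quadraticChar_mul_quadraticChar_trace hK h, Finset.sum_congr rfl fun b _ => hsq b,
    Finset.sum_boole, card_trace_ne_zero]
  ring

theorem stmt_13 (p m : ℕ) [Fact p.Prime] (hp2 : p ≠ 2) (hm : 2 ≤ m) (hmodd : Odd m)
    (F : Type) [Field F] [Fintype F] [DecidableEq F] [Algebra (ZMod p) F]
    (hcard : Fintype.card F = p ^ m) :
    2 * (({a : F | a ≠ 0 ∧
        quadraticChar F a * quadraticChar (ZMod p) (Algebra.trace (ZMod p) F a⁻¹) = 1}).ncard : ℤ)
      = ((p : ℤ) - 1) * ((p : ℤ) ^ (m - 1)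
          + (-1) ^ (((p - 1) / 2) * ((m - 1) / 2)) * (p : ℤ) ^ ((m - 1) / 2)) ∧
    2 * (({a : F | a ≠ 0 ∧
        quadraticChar F a * quadraticChar (ZMod p) (Algebra.trace (ZMod p) F a⁻¹) = -1}).ncard : ℤ)
      = ((p : ℤ) - 1) * ((p : ℤ) ^ (m - 1)
          - (-1) ^ (((p - 1) / 2) * ((m - 1) / 2)) * (p : ℤ) ^ ((m - 1) / 2)) := by
  have hringChar : ringChar (ZMod p) ≠ 2 := by rwa [ZMod.ringChar_zmod_n]
  have hrank : Module.finrank (ZMod p) F = m := by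
    have := Module.card_eq_pow_finrank (K := ZMod p) (V := F)
    rw [hcard, ZMod.card] at this
    exact (Nat.pow_right_injective (Fact.out : p.Prime).two_le this).symm
  have hodd : Odd (Module.finrank (ZMod p) F) := hrank.symm ▸ hmodd
  have hp : p % 2 = 1 := (Fact.out : p.Prime).eq_two_or_odd.resolve_left hp2
  have hneg : quadraticChar (ZMod p) (-1) = (-1) ^ ((p - 1) / 2) := by
    rw [quadraticChar_neg_one hringChar, ZMod.card, ZMod.χ₄_eq_neg_one_pow hp]
    congr 1
    omega
  have key (e : ℤ) (he : e = 1 ∨ e = -1) :=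
    two_mul_ncard_quadraticChar_mul_quadraticChar_trace_inv (L := F) hringChar hodd he
  simp only [hrank, hneg, ZMod.card, mul_pow, ← pow_mul] at key
  refine ⟨(key 1 (.inl rfl)).trans ?_, (key (-1) (.inr rfl)).trans ?_⟩ <;> ring
end

section
/- Let m be even and a ∈ F_r^*. The number N_a(0) of x ∈ F_r^* with Tr(x) = 0 and Tr(ax²) = 0 equals p^{m-2} − 1 if Tr(a^{-1}) ≠ 0, and equals p^{m-2} − 1 − (-1)^{((p-1)/2)·(m/2)} · η(a) · (p−1) · p^{(m-2)/2} if Tr(a^{-1}) = 0. -/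
open Finset

section QuadraticExpSum

variable {F : Type*} [Field F] [Fintype F] [DecidableEq F]

/-- The quadratic character of a finite field, with complex values. -/
noncomputable abbrev complexQuadraticChar (F : Type*) [Field F] [Fintype F] [DecidableEq F] :
    MulChar F ℂ :=
  (quadraticChar F).ringHomComp (Int.castRingHom ℂ)

/-- A sum over squares is a sum weighted by the number of square roots. -/
lemma sum_comp_sq (hF : ringChar F ≠ 2) (f : F → ℂ) :
    ∑ x : F, f (x ^ 2) = ∑ y : F, ((quadraticChar F y : ℂ) + 1) * f y := by
  rw [← Finset.sum_fiberwise_of_maps_to (t := univ) (g := fun x : F => x ^ 2) (by simp)]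
  refine Finset.sum_congr rfl fun y _ => ?_
  have h := quadraticChar_card_sqrts hF y
  have hc : (({x : F | x ^ 2 = y} : Finset F).card : ℂ) = (quadraticChar F y : ℂ) + 1 := by
    have : ({x : F | x ^ 2 = y} : Finset F) = {x : F | x ^ 2 = y}.toFinset := by
      ext; simp
    rw [this]
    exact_mod_cast h
  rw [← hc, ← nsmul_eq_mul, ← Finset.sum_const]
  refine Finset.sum_congr rfl fun x hx => ?_
  rw [(Finset.mem_filter.mp hx).2]

lemma sum_addChar_mul_sq_s17 (hF : ringChar F ≠ 2) {ψ : AddChar F ℂ} (hψ : ψ.IsPrimitive)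
    {b : F} (hb : b ≠ 0) :
    ∑ x : F, ψ (b * x ^ 2) = quadraticChar F b * gaussSum (complexQuadraticChar F) ψ := by
  rw [sum_comp_sq hF fun y => ψ (b * y)]
  have h0 : ∑ y : F, ψ (b * y) = 0 := by
    simpa [hb, mul_comm] using AddChar.sum_mulShift b hψ
  have h1 := gaussSum_mulShift (complexQuadraticChar F) ψ (Units.mk0 b hb)
  have h2 : (quadraticChar F b : ℂ) * quadraticChar F b = 1 := by
    rw [← pow_two]
    exact_mod_cast quadraticChar_sq_one hb
  simp only [add_mul, one_mul, Finset.sum_add_distrib, h0, add_zero]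
  rw [← h1]
  simp only [gaussSum, AddChar.mulShift_apply, Units.val_mk0, MulChar.ringHomComp_apply,
    eq_intCast, ← mul_assoc, h2, one_mul]

lemma sum_addChar_quadratic (hF : ringChar F ≠ 2) {ψ : AddChar F ℂ} (hψ : ψ.IsPrimitive)
    {b : F} (hb : b ≠ 0) (c : F) :
    ∑ x : F, ψ (b * x ^ 2 + c * x) =
      ψ (-(c ^ 2 / (4 * b))) *
        (quadraticChar F b * gaussSum (complexQuadraticChar F) ψ) := by
  have h2 : (2 : F) ≠ 0 := Ring.two_ne_zero hF
  have h4 : (4 : F) ≠ 0 := by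
    rw [show (4 : F) = 2 * 2 by norm_num]
    exact mul_ne_zero h2 h2
  rw [← sum_addChar_mul_sq_s17 hF hψ hb, Finset.mul_sum]
  refine Fintype.sum_equiv (Equiv.addRight (c / (2 * b))) _ _ fun x => ?_
  rw [← AddChar.map_add_eq_mul, Equiv.coe_addRight]
  congr 1
  field_simp
  ring

end QuadraticExpSum

section EvenDegree

variable {F : Type*} [Field F] [Fintype F] [DecidableEq F]

omit [Fintype F] [DecidableEq F] in
lemma intCast_neg_one_pow_inj (hF : ringChar F ≠ 2) {u : ℤ} (hu : u = 1 ∨ u = -1) {k : ℕ}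
    (h : (u : F) = (-1) ^ k) : u = (-1) ^ k := by
  have hne := Ring.neg_one_ne_one_of_char_ne_two hF
  rcases Nat.even_or_odd k with hk | hk <;> rw [hk.neg_one_pow] at h ⊢ <;>
    rcases hu with rfl | rfl
  · rfl
  · exact absurd (by simpa using h) hne
  · exact absurd (by simpa using h.symm) hne
  · rfl

lemma quadraticChar_of_pow_eq_self (hF : ringChar F ≠ 2) {j : ℕ}
    (hcard : Fintype.card F = (2 * j + 1) ^ 2) {y : F} (hy : y ≠ 0)
    (hyq : y ^ (2 * j + 1) = y) : quadraticChar F y = 1 := by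
  have h1 : y ^ (2 * j) = 1 := by
    apply mul_right_cancel₀ hy
    rw [← pow_succ, hyq, one_mul]
  rw [quadraticChar_eq_pow_of_char_ne_two hF hy, if_pos]
  have : Fintype.card F / 2 = 2 * j * (j + 1) := by
    rw [hcard, show (2 * j + 1) ^ 2 = 2 * (2 * j * (j + 1)) + 1 by ring]
    omega
  rw [this, pow_mul, h1, one_pow]

lemma quadraticChar_of_pow_eq_neg (hF : ringChar F ≠ 2) {j : ℕ}
    (hcard : Fintype.card F = (2 * j + 1) ^ 2) {y : F} (hy : y ≠ 0)
    (hyq : y ^ (2 * j + 1) = -y) : quadraticChar F y = (-1) ^ (j + 1) := by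
  have h1 : y ^ (2 * j) = -1 := by
    apply mul_right_cancel₀ hy
    rw [← pow_succ, hyq, neg_one_mul]
  apply intCast_neg_one_pow_inj hF (quadraticChar_dichotomy hy)
  rw [quadraticChar_eq_pow_of_char_ne_two' hF]
  have : Fintype.card F / 2 = 2 * j * (j + 1) := by
    rw [hcard, show (2 * j + 1) ^ 2 = 2 * (2 * j * (j + 1)) + 1 by ring]
    omega
  rw [this, pow_mul, h1]

/-- The quadratic Gauss sum over a field of order `q ^ 2`, with `q` odd, for an additive character
invariant under the `q`-power Frobenius. -/
lemma gaussSum_quadraticChar_of_card_eq_sq (hF : ringChar F ≠ 2) {j : ℕ}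
    (hcard : Fintype.card F = (2 * j + 1) ^ 2)
    (hadd : ∀ x y : F, (x + y) ^ (2 * j + 1) = x ^ (2 * j + 1) + y ^ (2 * j + 1))
    {ψ : AddChar F ℂ} (hψ : ψ.IsPrimitive) (hfrob : ∀ x, ψ (x ^ (2 * j + 1)) = ψ x) :
    gaussSum (complexQuadraticChar F) ψ = (-1) ^ (j + 1) * (2 * j + 1) := by
  set G := gaussSum (complexQuadraticChar F) ψ with hG
  set q := 2 * j + 1 with hq
  have hqq (x : F) : (x ^ q) ^ q = x := by
    rw [← pow_mul, ← pow_two, ← hcard, FiniteField.pow_card]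
  have hsum0 : ∑ x : F, (quadraticChar F x : ℂ) = 0 := by
    exact_mod_cast quadraticChar_sum_zero hF
  have hinner (u : F) : ∑ x : F, (quadraticChar F x : ℂ) * ψ (x * (u + u ^ q)) =
      if u + u ^ q = 0 then 0 else G := by
    split_ifs with h
    · simpa [h] using hsum0
    · have h1 := gaussSum_mulShift (complexQuadraticChar F) ψ (Units.mk0 _ h)
      have h2 : quadraticChar F (u + u ^ q) = 1 :=
        quadraticChar_of_pow_eq_self hF hcard h (by rw [← hq, hadd, hqq, add_comm])
      rw [hG, ← h1]
      simp [gaussSum, h2, mul_comm]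
  have houter (x : F) : ∑ u : F, (quadraticChar F x : ℂ) * ψ (x * (u + u ^ q)) =
      if x ^ q = -x ∧ x ≠ 0 then (-1) ^ (j + 1) * (q : ℂ) ^ 2 else 0 := by
    have h1 (u : F) : ψ (x * (u + u ^ q)) = ψ (u * (x + x ^ q)) := by
      rw [mul_add, mul_add, AddChar.map_add_eq_mul, AddChar.map_add_eq_mul,
        ← hfrob (x * u ^ q), mul_pow, hqq, mul_comm x u, mul_comm (x ^ q) u]
    simp only [h1, ← Finset.mul_sum]
    rw [AddChar.sum_mulShift _ hψ, hcard]
    by_cases hx : x = 0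
    · simp [hx]
    by_cases h : x ^ q = -x
    · rw [if_pos (by rw [h, add_neg_cancel]), if_pos ⟨h, hx⟩,
        quadraticChar_of_pow_eq_neg hF hcard hx h]
      push_cast
      rfl
    · rw [if_neg (fun h' => h (eq_neg_of_add_eq_zero_right h')), if_neg (fun h' => h h'.1)]
      simp
  have hswap : (({u : F | ¬ (u + u ^ q = 0)} : Finset F).card : ℂ) * G =
      (({x : F | x ^ q = -x ∧ x ≠ 0} : Finset F).card : ℂ) * ((-1) ^ (j + 1) * (q : ℂ) ^ 2) := by
    have h := Finset.sum_comm (s := (univ : Finset F)) (t := (univ : Finset F))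
      (f := fun u x => (quadraticChar F x : ℂ) * ψ (x * (u + u ^ q)))
    simp only [hinner, houter] at h
    simpa only [Finset.sum_ite, Finset.sum_const, Finset.sum_const_zero, zero_add, add_zero,
      mul_zero, nsmul_eq_mul] using h
  set A := ({u : F | ¬ (u + u ^ q = 0)} : Finset F).card with hA
  set K := ({x : F | x ^ q = -x ∧ x ≠ 0} : Finset F).card with hK
  have hpos : 0 < A + K := by
    by_contra! hAK
    have hA0 : A = 0 := by omega
    have hK0 : K = 0 := by omega
    rw [hA, Finset.card_eq_zero, Finset.filter_eq_empty_iff] at hA0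
    rw [hK, Finset.card_eq_zero, Finset.filter_eq_empty_iff] at hK0
    have h1 := hA0 (Finset.mem_univ (1 : F))
    exact hK0 (Finset.mem_univ (1 : F))
      ⟨eq_neg_of_add_eq_zero_right (not_not.mp h1), one_ne_zero⟩
  have hsq : G ^ 2 = (q : ℂ) ^ 2 := by
    have hne : complexQuadraticChar F ≠ 1 :=
      (MulChar.ringHomComp_ne_one_iff (Int.cast_injective)).mpr (quadraticChar_ne_one hF)
    have hquad : (complexQuadraticChar F).IsQuadratic :=
      (quadraticChar_isQuadratic F).comp _
    rw [gaussSum_sq hne hquad hψ, hcard]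
    have : quadraticChar F (-1) = 1 :=
      quadraticChar_of_pow_eq_self hF hcard (neg_ne_zero.mpr one_ne_zero)
        (Odd.neg_one_pow ⟨j, rfl⟩)
    simp [this]
  have hε : ((-1 : ℂ) ^ (j + 1)) * (-1) ^ (j + 1) = 1 := by
    rw [← mul_pow]; simp
  have hq' : (q : ℂ) = 2 * j + 1 := by rw [hq]; push_cast; rfl
  have hq0 : (q : ℂ) ≠ 0 := Nat.cast_ne_zero.mpr (by omega)
  have hfac : (G - (-1) ^ (j + 1) * q) * (G + (-1) ^ (j + 1) * q) = 0 := by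
    linear_combination hsq - (q : ℂ) ^ 2 * hε
  rcases mul_eq_zero.mp hfac with h | h
  · rw [← hq']
    exact sub_eq_zero.mp h
  · exfalso
    rw [eq_neg_of_add_eq_zero_left h] at hswap
    have h3 : ((A + K * q : ℕ) : ℂ) * q = 0 := by
      push_cast
      linear_combination (-(-1) ^ (j + 1)) * hswap - (A * q + K * (q : ℂ) ^ 2) * hε
    have h4 : A + K * q = 0 := by
      exact_mod_cast (mul_eq_zero.mp h3).resolve_right hq0
    have : K ≤ K * q := Nat.le_mul_of_pos_right _ (by omega)
    omega

end EvenDegree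

section PrimeField

variable {p : ℕ} [Fact p.Prime] {F : Type*} [Field F] [Fintype F] [Algebra (ZMod p) F]

/-- The canonical additive character `x ↦ exp (2πi Tr(x) / p)` of a finite field. -/
noncomputable def traceAddChar (p : ℕ) [Fact p.Prime] (F : Type*) [Field F]
    [Algebra (ZMod p) F] : AddChar F ℂ :=
  (ZMod.stdAddChar (N := p)).compAddMonoidHom (Algebra.trace (ZMod p) F).toAddMonoidHom

omit [Fintype F] in
lemma traceAddChar_apply (x : F) :
    traceAddChar p F x = ZMod.stdAddChar (Algebra.trace (ZMod p) F x) := rfl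

lemma traceAddChar_isPrimitive : (traceAddChar p F).IsPrimitive := by
  apply AddChar.IsPrimitive.of_ne_one
  obtain ⟨x, hx⟩ := Algebra.trace_surjective (ZMod p) F 1
  have h1 : (ZMod.stdAddChar (N := p)) 1 ≠ 1 := by
    intro h
    have := ZMod.injective_stdAddChar (N := p) (h.trans (AddChar.map_zero_eq_one _).symm)
    exact one_ne_zero this
  intro h
  apply h1
  rw [← hx, ← traceAddChar_apply, h, AddChar.one_apply]

lemma trace_pow_prime_pow (n : ℕ) (x : F) :
    Algebra.trace (ZMod p) F (x ^ p ^ n) = Algebra.trace (ZMod p) F x := by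
  induction n with
  | zero => simp
  | succ n ih =>
    have h := Algebra.trace_eq_of_algEquiv
      (FiniteField.frobeniusAlgEquivOfAlgebraic (ZMod p) F) (x ^ p ^ n)
    rw [FiniteField.coe_frobeniusAlgEquivOfAlgebraic, ZMod.card] at h
    rw [pow_succ, pow_mul, h, ih]

lemma sum_stdAddChar_mul (t : ZMod p) :
    ∑ s : ZMod p, (ZMod.stdAddChar (s * t) : ℂ) = if t = 0 then (p : ℂ) else 0 := by
  rw [AddChar.sum_mulShift t (ZMod.isPrimitive_stdAddChar p), ZMod.card]
  split_ifs <;> simp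

/-- For `q = p ^ n` odd, `(-1) ^ (q / 2)` in terms of `p` and `n`. -/
lemma neg_one_pow_half_pow {p : ℕ} (hp : p % 2 = 1) (n : ℕ) :
    (-1 : ℤ) ^ (p ^ n / 2) = (-1) ^ ((p - 1) / 2 * n) := by
  have h : p ^ n % 2 = 1 := Nat.odd_iff.mp ((Nat.odd_iff.mpr hp).pow)
  rw [← ZMod.χ₄_eq_neg_one_pow h, Nat.cast_pow, map_pow, ZMod.χ₄_eq_neg_one_pow hp,
    ← pow_mul]
  congr 2
  omega

lemma gaussSum_traceAddChar [DecidableEq F] (hp : p % 2 = 1) {n : ℕ}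
    (hcard : Fintype.card F = p ^ (2 * n)) (hF : ringChar F ≠ 2) :
    gaussSum (complexQuadraticChar F) (traceAddChar p F) =
      -(-1) ^ ((p - 1) / 2 * n) * (p : ℂ) ^ n := by
  have h : p ^ n % 2 = 1 := Nat.odd_iff.mp ((Nat.odd_iff.mpr hp).pow)
  have hj : p ^ n = 2 * (p ^ n / 2) + 1 := by omega
  have : CharP F p := charP_of_injective_algebraMap (algebraMap (ZMod p) F).injective p
  rw [gaussSum_quadraticChar_of_card_eq_sq hF (j := p ^ n / 2)
    (by rw [← hj, hcard, mul_comm, pow_mul])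
    (by rw [← hj]; exact fun x y => add_pow_char_pow x y p n)
    traceAddChar_isPrimitive
    (by rw [← hj]; exact fun x => by rw [traceAddChar_apply, trace_pow_prime_pow,
          traceAddChar_apply])]
  have h1 : (-1 : ℂ) ^ (p ^ n / 2) = (-1) ^ ((p - 1) / 2 * n) := by
    exact_mod_cast congrArg (Int.cast : ℤ → ℂ) (neg_one_pow_half_pow hp n)
  have h2 : (2 * ((p ^ n / 2 : ℕ) : ℂ) + 1) = (p : ℂ) ^ n := by
    exact_mod_cast hj.symm
  rw [h2, pow_succ, h1]
  ring

lemma quadraticChar_algebraMap_zmod [DecidableEq F] (hp : p % 2 = 1) {n : ℕ}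
    (hcard : Fintype.card F = p ^ (2 * n)) (hF : ringChar F ≠ 2) {t : ZMod p} (ht : t ≠ 0) :
    quadraticChar F (algebraMap (ZMod p) F t) = 1 := by
  have h : p ^ n % 2 = 1 := Nat.odd_iff.mp ((Nat.odd_iff.mpr hp).pow)
  have hj : p ^ n = 2 * (p ^ n / 2) + 1 := by omega
  refine quadraticChar_of_pow_eq_self hF (j := p ^ n / 2)
    (by rw [← hj, hcard, mul_comm, pow_mul])
    (by simpa using ht) ?_
  rw [← hj, ← map_pow, ZMod.pow_card_pow]

/-- The number of common zeros of two functions as a character sum. -/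
lemma sq_mul_card_filter_eq_sum {X : Type*} [Fintype X] (f g : X → ZMod p) :
    (p : ℂ) ^ 2 * (({x : X | f x = 0 ∧ g x = 0} : Finset X).card : ℂ) =
      ∑ t : ZMod p, ∑ s : ZMod p, ∑ x : X, (ZMod.stdAddChar (t * g x + s * f x) : ℂ) := by
  have h (x : X) : ∑ t : ZMod p, ∑ s : ZMod p, (ZMod.stdAddChar (t * g x + s * f x) : ℂ) =
      if f x = 0 ∧ g x = 0 then (p : ℂ) ^ 2 else 0 := by
    simp only [AddChar.map_add_eq_mul, ← Finset.mul_sum, ← Finset.sum_mul, sum_stdAddChar_mul]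
    split_ifs <;> simp_all [pow_two]
  calc _ = ∑ x : X, ∑ t : ZMod p, ∑ s : ZMod p,
        (ZMod.stdAddChar (t * g x + s * f x) : ℂ) := by
        simp only [h, ← Finset.sum_filter, Finset.sum_const, nsmul_eq_mul, mul_comm]
    _ = _ := by
        rw [Finset.sum_comm]
        exact Finset.sum_congr rfl fun t _ => Finset.sum_comm

lemma sum_stdAddChar_sq_div (hp2 : (4 : ZMod p) ≠ 0) (c : ZMod p) :
    ∑ t ∈ univ.erase (0 : ZMod p), ∑ s : ZMod p,
      (ZMod.stdAddChar (-(s ^ 2 * c / (4 * t))) : ℂ) =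
      if c = 0 then ((p : ℂ) - 1) * p else 0 := by
  have hp1 : 1 ≤ p := (Fact.out : p.Prime).one_le
  have hcardE : ((univ.erase (0 : ZMod p)).card : ℂ) = (p : ℂ) - 1 := by
    rw [Finset.card_erase_of_mem (Finset.mem_univ _), Finset.card_univ, ZMod.card]
    push_cast [hp1]
    rfl
  split_ifs with hc
  · simp [hc, ZMod.card, Nat.cast_pred hp1]
  rw [Finset.sum_comm, ← Finset.add_sum_erase _ _ (Finset.mem_univ (0 : ZMod p))]
  have hs (s : ZMod p) (hs : s ∈ univ.erase (0 : ZMod p)) :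
      ∑ t ∈ univ.erase (0 : ZMod p), (ZMod.stdAddChar (-(s ^ 2 * c / (4 * t))) : ℂ) = -1 := by
    have hs0 : s ≠ 0 := Finset.ne_of_mem_erase hs
    have hd : -(s ^ 2 * c / 4) ≠ 0 :=
      neg_ne_zero.mpr (div_ne_zero (mul_ne_zero (pow_ne_zero 2 hs0) hc) hp2)
    have h0 := sum_stdAddChar_mul (-(s ^ 2 * c / 4))
    rw [if_neg hd, ← Finset.add_sum_erase _ _ (Finset.mem_univ (0 : ZMod p)), zero_mul,
      AddChar.map_zero_eq_one] at h0
    rw [← eq_neg_of_add_eq_zero_right h0]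
    refine Finset.sum_bij' (fun t _ => t⁻¹) (fun t _ => t⁻¹) ?_ ?_ ?_ ?_ ?_
    · simp
    · simp
    · simp
    · simp
    · intro t ht
      have : t ≠ 0 := Finset.ne_of_mem_erase ht
      congr 1
      field_simp
  rw [Finset.sum_congr rfl hs]
  simp [ZMod.card, Nat.cast_pred hp1]

/-- The number of trace-zero elements `x`, including `0`, with `Tr(ax²) = 0`. -/
lemma sq_mul_card_trace_eq_zero [DecidableEq F] (hp : p % 2 = 1) {n : ℕ}
    (hcard : Fintype.card F = p ^ (2 * n)) (hF : ringChar F ≠ 2) {a : F} (ha : a ≠ 0) :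
    (p : ℂ) ^ 2 * (({x : F | Algebra.trace (ZMod p) F x = 0 ∧
        Algebra.trace (ZMod p) F (a * x ^ 2) = 0} : Finset F).card : ℂ) =
      (p : ℂ) ^ (2 * n) + (if Algebra.trace (ZMod p) F a⁻¹ = 0 then ((p : ℂ) - 1) * p else 0) *
        (quadraticChar F a * (-(-1) ^ ((p - 1) / 2 * n) * (p : ℂ) ^ n)) := by
  have hcomb (t s : ZMod p) (x : F) :
      (ZMod.stdAddChar (t * Algebra.trace (ZMod p) F (a * x ^ 2) +
        s * Algebra.trace (ZMod p) F x) : ℂ) =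
      traceAddChar p F (algebraMap (ZMod p) F t * a * x ^ 2 + algebraMap (ZMod p) F s * x) := by
    rw [traceAddChar_apply, mul_assoc, ← Algebra.smul_def, ← Algebra.smul_def,
      map_add (Algebra.trace (ZMod p) F), map_smul, map_smul, smul_eq_mul, smul_eq_mul]
  have h4F : (4 : F) ≠ 0 := by
    rw [show (4 : F) = 2 * 2 by norm_num]
    exact mul_ne_zero (Ring.two_ne_zero hF) (Ring.two_ne_zero hF)
  have h4 : (4 : ZMod p) ≠ 0 := by
    intro h
    apply h4F
    rw [← map_ofNat (algebraMap (ZMod p) F) 4, h, map_zero]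
  rw [sq_mul_card_filter_eq_sum, ← Finset.add_sum_erase _ _ (Finset.mem_univ (0 : ZMod p))]
  congr 1
  · have h (s : ZMod p) : ∑ x : F, traceAddChar p F (algebraMap (ZMod p) F s * x) =
        if s = 0 then (p : ℂ) ^ (2 * n) else 0 := by
      have := AddChar.sum_mulShift (algebraMap (ZMod p) F s)
        (traceAddChar_isPrimitive (p := p) (F := F))
      simp only [mul_comm _ (algebraMap (ZMod p) F s), hcard] at this
      rw [this]
      split_ifs <;> simp_all
    simp only [hcomb]
    simp [h]
  · rw [← sum_stdAddChar_sq_div h4, Finset.sum_mul]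
    refine Finset.sum_congr rfl fun t ht => ?_
    have ht0 : t ≠ 0 := Finset.ne_of_mem_erase ht
    have htF : algebraMap (ZMod p) F t ≠ 0 := by simpa using ht0
    rw [Finset.sum_mul]
    refine Finset.sum_congr rfl fun s _ => ?_
    simp only [hcomb]
    rw [sum_addChar_quadratic hF traceAddChar_isPrimitive (mul_ne_zero htF ha), map_mul,
      quadraticChar_algebraMap_zmod hp hcard hF ht0, one_mul,
      gaussSum_traceAddChar hp hcard hF, traceAddChar_apply]
    congr 2
    have : -((algebraMap (ZMod p) F) s ^ 2 / (4 * ((algebraMap (ZMod p) F) t * a))) =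
        (-(s ^ 2 / (4 * t))) • a⁻¹ := by
      rw [Algebra.smul_def]
      simp only [map_neg, map_div₀, map_mul, map_pow, map_ofNat]
      field_simp
    rw [this, map_smul, smul_eq_mul]
    ring

end PrimeField

theorem stmt_17 (p m : ℕ) [Fact p.Prime] (hp2 : p ≠ 2) (hm : 2 ≤ m) (hmeven : Even m)
    (F : Type) [Field F] [Fintype F] [DecidableEq F] [Algebra (ZMod p) F]
    (hcard : Fintype.card F = p ^ m)
    (a : F) (ha : a ≠ 0) :
    (Algebra.trace (ZMod p) F a⁻¹ ≠ 0 →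
      (({x : F | x ≠ 0 ∧ Algebra.trace (ZMod p) F x = 0 ∧
          Algebra.trace (ZMod p) F (a * x ^ 2) = 0}).ncard : ℤ)
        = (p : ℤ) ^ (m - 2) - 1) ∧
    (Algebra.trace (ZMod p) F a⁻¹ = 0 →
      (({x : F | x ≠ 0 ∧ Algebra.trace (ZMod p) F x = 0 ∧
          Algebra.trace (ZMod p) F (a * x ^ 2) = 0}).ncard : ℤ)
        = (p : ℤ) ^ (m - 2) - 1
          - (-1) ^ (((p - 1) / 2) * (m / 2)) * quadraticChar F a
            * ((p : ℤ) - 1) * (p : ℤ) ^ ((m - 2) / 2)) := by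
  have hp : p.Prime := Fact.out
  obtain ⟨k, rfl⟩ : ∃ k, m = 2 * (k + 1) := by
    obtain ⟨n, hn⟩ := hmeven
    exact ⟨n - 1, by omega⟩
  have hodd : p % 2 = 1 := hp.eq_two_or_odd.resolve_left hp2
  have hF : ringChar F ≠ 2 := by
    have : CharP F p := charP_of_injective_algebraMap (algebraMap (ZMod p) F).injective p
    rwa [ringChar.eq F p]
  have hmain := sq_mul_card_trace_eq_zero hodd hcard hF ha
  set S := ({x : F | Algebra.trace (ZMod p) F x = 0 ∧
    Algebra.trace (ZMod p) F (a * x ^ 2) = 0} : Finset F) with hS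
  have hset : {x : F | x ≠ 0 ∧ Algebra.trace (ZMod p) F x = 0 ∧
      Algebra.trace (ZMod p) F (a * x ^ 2) = 0} = (S.erase 0 : Finset F) := by
    ext x
    simp [hS, and_comm]
  have hN : ((S.erase 0).card : ℤ) = S.card - 1 := by
    have h0 : (0 : F) ∈ S := by simp [hS]
    have := Finset.card_erase_add_one h0
    omega
  have hpC : (p : ℂ) ≠ 0 := Nat.cast_ne_zero.mpr hp.ne_zero
  rw [hset, Set.ncard_coe_finset, hN, show 2 * (k + 1) - 2 = 2 * k by omega,
    show 2 * (k + 1) / 2 = k + 1 by omega, show 2 * k / 2 = k by omega]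
  constructor <;> intro htr
  · rw [if_neg htr, zero_mul, add_zero] at hmain
    have : (S.card : ℂ) = (p : ℂ) ^ (2 * k) := by
      apply mul_left_cancel₀ (pow_ne_zero 2 hpC)
      rw [hmain]
      ring
    have h' : (S.card : ℤ) = (p : ℤ) ^ (2 * k) := by exact_mod_cast this
    rw [h']
  · rw [if_pos htr] at hmain
    have : (S.card : ℂ) = (p : ℂ) ^ (2 * k) - (-1) ^ ((p - 1) / 2 * (k + 1)) *
        quadraticChar F a * ((p : ℂ) - 1) * (p : ℂ) ^ k := by
      apply mul_left_cancel₀ (pow_ne_zero 2 hpC)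
      rw [hmain]
      ring
    have h' : (S.card : ℤ) = (p : ℤ) ^ (2 * k) - (-1) ^ ((p - 1) / 2 * (k + 1)) *
        quadraticChar F a * ((p : ℤ) - 1) * (p : ℤ) ^ k := by
      exact_mod_cast this
    rw [h']
    ring
end
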